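/- Let (X,d) be a compact metric space and f : X → X a continuous map which is positively expansive and has the shadowing property. If f has infinitely many periodic points, then f has positive topological entropy. -/

import Mathlib

open Filter Topology Set
open scoped ENNReal

variable {X : Type*}

/-- A sequence `(x i)` is a `δ`-pseudo-orbit for `f` if `dist (f (x i)) (x (i+1)) < δ`
for every `i ≥ 0`. -/
def IsPseudoOrbit [MetricSpace X] (f : X → X) (δ : ℝ) (x : ℕ → X) : Prop :=
  ∀ i : ℕ, dist (f (x i)) (x (i + 1)) < δ

/-- A sequence `(x i)` is `ε`-shadowed by the point `y`. -/
def IsShadowedBy [MetricSpace X] (f : X → X) (ε : ℝ) (x : ℕ → X) (y : X) : Prop :=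
  ∀ i : ℕ, dist (f^[i] y) (x i) < ε

/-- A point `x₀` is shadowable: for every `ε > 0` there is `δ > 0` such that every
`δ`-pseudo-orbit starting at `x₀` is `ε`-shadowed by some point. -/
def ShadowablePoint [MetricSpace X] (f : X → X) (x₀ : X) : Prop :=
  ∀ ε > (0 : ℝ), ∃ δ > (0 : ℝ), ∀ x : ℕ → X, IsPseudoOrbit f δ x → x 0 = x₀ →
    ∃ y : X, IsShadowedBy f ε x y

/-- `f` has the shadowing property. -/
def ShadowingProperty [MetricSpace X] (f : X → X) : Prop :=
  ∀ ε > (0 : ℝ), ∃ δ > (0 : ℝ), ∀ x : ℕ → X, IsPseudoOrbit f δ x →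
    ∃ y : X, IsShadowedBy f ε x y

/-- A sequence of maps `F n` has the uniform shadowing property: each `F n` has the shadowing
property and, for every `ε > 0`, one single `δ > 0` works for all the maps `F n`. -/
def UniformShadowing [MetricSpace X] (F : ℕ → X → X) : Prop :=
  (∀ n, ShadowingProperty (F n)) ∧
    ∀ ε > (0 : ℝ), ∃ δ > (0 : ℝ), ∀ n, ∀ x : ℕ → X, IsPseudoOrbit (F n) δ x →
      ∃ y : X, IsShadowedBy (F n) ε x y

/-- A point `x` is nonwandering for `f` if every neighborhood `U` of `x` satisfies
`f^n(U) ∩ U ≠ ∅` for some `n ≥ 1`. -/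
def NonwanderingPt [MetricSpace X] (f : X → X) (x : X) : Prop :=
  ∀ U ∈ 𝓝 x, ∃ n : ℕ, 1 ≤ n ∧ (f^[n] '' U ∩ U).Nonempty

/-- `s_n(V, ε)`: the maximal cardinality of an `(n, ε)`-separated subset of `V`. -/
noncomputable def sepNum [MetricSpace X] (f : X → X) (V : Set X) (n : ℕ) (ε : ℝ) : ℕ :=
  sSup {k : ℕ | ∃ E : Finset X, ↑E ⊆ V ∧ E.card = k ∧
    ∀ x ∈ E, ∀ y ∈ E, x ≠ y → ∃ i ≤ n, ε ≤ dist (f^[i] x) (f^[i] y)}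

/-- `lim_{ε → 0} limsup_{n → ∞} (1/n) log s_n(V, ε)`, as a supremum over `ε > 0`
(the inner quantity is monotone as `ε` decreases). -/
noncomputable def entropyWithin [MetricSpace X] (f : X → X) (V : Set X) : ℝ≥0∞ :=
  ⨆ (ε : ℝ) (_ : 0 < ε),
    Filter.limsup (fun n : ℕ => ENNReal.ofReal (Real.log (sepNum f V n ε) / n)) Filter.atTop

/-- The topological entropy of `f`. -/
noncomputable def topEntropy [MetricSpace X] (f : X → X) : ℝ≥0∞ :=
  entropyWithin f Set.univ

/-- `f` is positively expansive. -/
def PosExpansive [MetricSpace X] (f : X → X) : Prop :=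
  ∃ e > (0 : ℝ), ∀ x y : X, (∀ i : ℕ, dist (f^[i] x) (f^[i] y) < e) → x = y

/-- In a compact space, the cardinalities of the `(n, ε)`-separated sets are bounded. -/
lemma bddAbove_card_separated [MetricSpace X] [CompactSpace X] {f : X → X} (hf : Continuous f)
    (V : Set X) (n : ℕ) {ε : ℝ} (hε : 0 < ε) :
    BddAbove {k : ℕ | ∃ E : Finset X, ↑E ⊆ V ∧ E.card = k ∧
      ∀ x ∈ E, ∀ y ∈ E, x ≠ y → ∃ i ≤ n, ε ≤ dist (f^[i] x) (f^[i] y)} := by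
  have hU : ∀ x : X, {y | ∀ i ∈ Finset.range (n + 1), dist (f^[i] y) (f^[i] x) < ε / 2} ∈ 𝓝 x := by
    intro x
    refine (Filter.eventually_all_finset _).2 fun i _ => ?_
    exact (hf.iterate i).continuousAt.eventually (Metric.ball_mem_nhds _ (half_pos hε))
  obtain ⟨t, -, ht⟩ := isCompact_univ.elim_nhds_subcover _ fun x _ => hU x
  refine ⟨t.card, ?_⟩
  rintro k ⟨E, -, rfl, hE⟩
  have hc : ∀ x : X, ∃ c ∈ t, ∀ i ∈ Finset.range (n + 1), dist (f^[i] x) (f^[i] c) < ε / 2 := by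
    intro x
    simpa only [mem_iUnion, exists_prop, mem_ofPred_eq] using ht (mem_univ x)
  choose c hct hc using hc
  refine Finset.card_le_card_of_injOn c (fun x _ => hct x) fun x hx y hy hxy => ?_
  by_contra hne
  obtain ⟨i, hi, hd⟩ := hE x hx y hy hne
  have hi' : i ∈ Finset.range (n + 1) := Finset.mem_range.2 (by omega)
  have h1 := hc x i hi'
  have h2 := hc y i hi'
  rw [← hxy] at h2
  linarith [dist_triangle_right (f^[i] x) (f^[i] y) (f^[i] (c x))]

/-- The pseudo-orbit following, on each block of `k` consecutive times, the orbit segment of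
the point prescribed for that block. -/
lemma isPseudoOrbit_blocks [MetricSpace X] {f : X → X} {δ : ℝ} {k : ℕ} (hk : 1 ≤ k) (a : ℕ → X)
    (hper : ∀ j, f^[k] (a j) = a j) (hδ : ∀ i j, dist (a i) (a j) < δ) :
    IsPseudoOrbit f δ fun i => f^[i % k] (a (i / k)) := by
  intro i
  have hδ0 : 0 < δ := dist_nonneg.trans_lt (hδ 0 0)
  have hlt : i % k < k := Nat.mod_lt _ hk
  have hi := Nat.div_add_mod i k
  simp only [← Function.iterate_succ_apply' f]
  by_cases h : i % k + 1 = k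
  · have hs : i + 1 = k * (i / k + 1) := by rw [mul_add, mul_one]; omega
    rw [Nat.succ_eq_add_one, h, hper, hs, Nat.mul_mod_right, Nat.mul_div_cancel_left _ hk]
    exact hδ _ _
  · have hs : i + 1 = k * (i / k) + (i % k + 1) := by omega
    have hr : i % k + 1 < k := by omega
    have hm : (i + 1) % k = i % k + 1 := by
      rw [hs, Nat.mul_add_mod, Nat.mod_eq_of_lt hr]
    have hd : (i + 1) / k = i / k := by
      rw [hs, Nat.mul_add_div hk, Nat.div_eq_of_lt hr, add_zero]
    rw [hm, hd, Nat.succ_eq_add_one, dist_self]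
    exact hδ0

/-- An infinite subset of a compact metric space has distinct points arbitrarily close
to each other. -/
lemma Set.Infinite.exists_ne_dist_lt [MetricSpace X] [CompactSpace X] {S : Set X}
    (hS : S.Infinite) {δ : ℝ} (hδ : 0 < δ) : ∃ p ∈ S, ∃ q ∈ S, p ≠ q ∧ dist p q < δ := by
  obtain ⟨z, hz⟩ := hS.exists_accPt_principal
  have hz' := accPt_iff_frequently.1 hz
  obtain ⟨p, ⟨hpz, hpS⟩, hp⟩ :=
    (hz'.and_eventually (Metric.ball_mem_nhds z (half_pos hδ))).exists
  have hr : 0 < min (δ / 2) (dist p z) := lt_min (half_pos hδ) (dist_pos.2 hpz)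
  obtain ⟨q, ⟨-, hqS⟩, hq⟩ := (hz'.and_eventually (Metric.ball_mem_nhds z hr)).exists
  rw [lt_min_iff] at hq
  refine ⟨p, hpS, q, hqS, ?_, ?_⟩
  · rintro rfl
    exact lt_irrefl _ hq.2
  · linarith [dist_triangle_right p q z, hq.1]

/-- If the pseudo-orbits switching between two points of common period `k` are `ε`-shadowed,
and the orbits of these points are at distance at least `3 * ε` at some time, then there are at
least `2 ^ m` orbit segments of length `m * k` which are pairwise `ε`-separated. -/
lemma two_pow_le_sepNum [MetricSpace X] [CompactSpace X] {f : X → X} (hf : Continuous f)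
    {ε δ : ℝ} (hε : 0 < ε)
    (hshad : ∀ x : ℕ → X, IsPseudoOrbit f δ x → ∃ y : X, IsShadowedBy f ε x y)
    {p q : X} {k : ℕ} (hk : 1 ≤ k) (hp : f^[k] p = p) (hq : f^[k] q = q) (hpq : dist p q < δ)
    {r : ℕ} (hr : r < k) (hsep : 3 * ε ≤ dist (f^[r] p) (f^[r] q)) (m : ℕ) :
    2 ^ m ≤ sepNum f univ (m * k) ε := by
  classical
  let b : Bool → X := fun c => if c then p else q
  let a : (Fin m → Bool) → ℕ → X := fun w j => b (if h : j < m then w ⟨j, h⟩ else false)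
  have hb : ∀ c, f^[k] (b c) = b c := by rintro (_ | _) <;> simp [b, hp, hq]
  have hδ0 : 0 < δ := dist_nonneg.trans_lt hpq
  have hbd : ∀ c c', dist (b c) (b c') < δ := by
    rintro (_ | _) (_ | _) <;> simp [b, hδ0, hpq, dist_comm q p]
  have hbs : ∀ c c', c ≠ c' → 3 * ε ≤ dist (f^[r] (b c)) (f^[r] (b c')) := by
    rintro (_ | _) (_ | _) h
    · exact absurd rfl h
    · simpa [b, dist_comm] using hsep
    · simpa [b] using hsep
    · exact absurd rfl h
  have hy : ∀ w, ∃ y, IsShadowedBy f ε (fun i => f^[i % k] (a w (i / k))) y := fun w =>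
    hshad _ (isPseudoOrbit_blocks hk (a w) (fun _ => hb _) fun _ _ => hbd _ _)
  choose y hy using hy
  have hys : ∀ w w', w ≠ w' → ∃ i ≤ m * k, ε ≤ dist (f^[i] (y w)) (f^[i] (y w')) := by
    intro w w' hne
    obtain ⟨j, hj⟩ := Function.ne_iff.1 hne
    have hjm : (j : ℕ) + 1 ≤ m := j.2
    refine ⟨k * j + r, ?_, ?_⟩
    · have := Nat.mul_le_mul_left k hjm
      rw [mul_add, mul_one, mul_comm k m] at this
      omega
    · have h1 := hy w (k * j + r)
      have h2 := hy w' (k * j + r)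
      have hm : (k * j + r) % k = r := by rw [Nat.mul_add_mod, Nat.mod_eq_of_lt hr]
      have hd : (k * j + r) / k = j := by
        rw [Nat.mul_add_div hk, Nat.div_eq_of_lt hr, add_zero]
      have h3 : ∀ v, a v j = b (v j) := fun v => by simp [a]
      simp only [hm, hd, h3] at h1 h2
      rw [dist_comm] at h1
      have h4 := hbs _ _ hj
      have h5 := dist_triangle4 (f^[r] (b (w j))) (f^[k * j + r] (y w)) (f^[k * j + r] (y w'))
        (f^[r] (b (w' j)))
      linarith
  have hinj : Function.Injective y := by
    intro w w' h
    by_contra hne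
    obtain ⟨i, -, hi⟩ := hys w w' hne
    rw [h, dist_self] at hi
    exact hi.not_gt hε
  refine le_csSup (bddAbove_card_separated hf univ (m * k) hε)
    ⟨Finset.univ.image y, subset_univ _, ?_, ?_⟩
  · rw [Finset.card_image_of_injective _ hinj]
    simp
  · simp only [Finset.mem_image, Finset.mem_univ, true_and]
    rintro _ ⟨w, rfl⟩ _ ⟨w', rfl⟩ h
    exact hys w w' fun h' => h (congrArg y h')

/-- Exponential growth of the separated sets along multiples of `k` gives positive entropy. -/
lemma topEntropy_pos_of_two_pow_le_sepNum [MetricSpace X] {f : X → X} {ε : ℝ} (hε : 0 < ε)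
    {k : ℕ} (hk : 1 ≤ k) (h : ∀ m : ℕ, 2 ^ m ≤ sepNum f univ (m * k) ε) :
    0 < topEntropy f := by
  have hk0 : (0 : ℝ) < k := by exact_mod_cast hk
  have hlog : 0 < Real.log 2 := Real.log_pos one_lt_two
  have hpos : 0 < ENNReal.ofReal (Real.log 2 / k) := ENNReal.ofReal_pos.2 (div_pos hlog hk0)
  refine hpos.trans_le (le_trans ?_ (le_iSup₂ (f := fun (ε : ℝ) (_ : 0 < ε) =>
    limsup (fun n : ℕ => ENNReal.ofReal (Real.log (sepNum f univ n ε) / n)) atTop) ε hε))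
  refine le_limsup_of_frequently_le (frequently_atTop.2 fun N => ⟨(N + 1) * k, ?_, ?_⟩)
  · exact (Nat.le_succ N).trans (Nat.le_mul_of_pos_right _ hk)
  · refine ENNReal.ofReal_le_ofReal ?_
    have hN : (0 : ℝ) < ((N + 1 : ℕ) : ℝ) := by positivity
    have h2 : ((2 : ℝ) ^ (N + 1)) ≤ sepNum f univ ((N + 1) * k) ε := by exact_mod_cast h (N + 1)
    have h3 := Real.log_le_log (by positivity) h2
    rw [Real.log_pow] at h3
    rw [Nat.cast_mul, div_le_div_iff₀ hk0 (mul_pos hN hk0)]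
    nlinarith [mul_le_mul_of_nonneg_right h3 hk0.le]

/-- Corollary: a positively expansive map with the shadowing property and infinitely many
periodic points has positive topological entropy. -/
theorem stmt2 [MetricSpace X] [CompactSpace X] (f : X → X) (hf : Continuous f)
    (hexp : PosExpansive f) (hshad : ShadowingProperty f)
    (hper : {p : X | ∃ k : ℕ, 1 ≤ k ∧ f^[k] p = p}.Infinite) :
    0 < topEntropy f := by
  obtain ⟨e, he, hexp⟩ := hexp
  have hε : 0 < e / 3 := by positivity
  obtain ⟨δ, hδ, hsh⟩ := hshad (e / 3) hε
  obtain ⟨p, ⟨k, hk, hp⟩, q, ⟨l, hl, hq⟩, hne, hpq⟩ := hper.exists_ne_dist_lt hδ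
  have hp' : Function.IsPeriodicPt f (k * l) p := Function.IsPeriodicPt.mul_const hp l
  have hq' : Function.IsPeriodicPt f (k * l) q := Function.IsPeriodicPt.const_mul hq k
  have hkl : 1 ≤ k * l := Nat.mul_pos hk hl
  obtain ⟨i, hi⟩ : ∃ i, e ≤ dist (f^[i] p) (f^[i] q) := by
    by_contra! hcon
    exact hne (hexp p q hcon)
  rw [← hp'.iterate_mod_apply, ← hq'.iterate_mod_apply] at hi
  exact topEntropy_pos_of_two_pow_le_sepNum hε hkl fun m =>
    two_pow_le_sepNum hf hε hsh hkl hp' hq' hpq (Nat.mod_lt i hkl) (by linarith) m
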